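/- Let p ∈ (1,∞) with p ≠ 2. Suppose the finite simple graph G = (V,E) has at least six vertices, and that (G,q) is a framework in ℓ_{2,p}³ which is completely full and infinitesimally rigid, and such that for every edge e ∈ E the framework (G − e, q) is not infinitesimally rigid. Then G is (3,4)-tight, i.e. |E| = 3|V| − 4 and every subgraph (V',E') of G with at least one edge satisfies |E'| ≤ 3|V'| − 4. -/

import Mathlib

/-- The mixed (2,p)-norm on ℝ³: ‖(x,y,z)‖_{2,p} = ((x²+y²)^{p/2} + |z|^p)^{1/p}. -/
noncomputable def norm2p (p : ℝ) (v : Fin 3 → ℝ) : ℝ :=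
  ((v 0 ^ 2 + v 1 ^ 2) ^ (p / 2) + |v 2| ^ p) ^ (1 / p)

/-- m is an infinitesimal flex of the framework (G,q) in ℓ_{2,p}³: for each edge vw,
the derivative at t = 0 of t ↦ ‖(q_v + t m_v) − (q_w + t m_w)‖_{2,p} is zero. -/
def IsFlexM (p : ℝ) {V : Type*} (G : SimpleGraph V) (q m : V → Fin 3 → ℝ) : Prop :=
  ∀ v w, G.Adj v w →
    HasDerivAt (fun t : ℝ => norm2p p ((q v + t • m v) - (q w + t • m w))) 0 0

/-- m is a trivial infinitesimal flex: it arises from an infinitesimal rigid motion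
x ↦ λ(−x₂, x₁, 0) + c of ℓ_{2,p}³. -/
def TrivFlex {V : Type*} (q m : V → Fin 3 → ℝ) : Prop :=
  ∃ (lam : ℝ) (c : Fin 3 → ℝ), ∀ v, m v = lam • ![-(q v 1), q v 0, (0 : ℝ)] + c

/-- The framework (G,q) in ℓ_{2,p}³ is infinitesimally rigid. -/
def RigidM (p : ℝ) {V : Type*} (G : SimpleGraph V) (q : V → Fin 3 → ℝ) : Prop :=
  ∀ m : V → Fin 3 → ℝ, IsFlexM p G q m → TrivFlex q m

/-- The placement q is full on the vertex set S: the only infinitesimal rigid motion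
η(x) = λ(−x₂,x₁,0) + c of ℓ_{2,p}³ vanishing at q_v for all v ∈ S is the zero map. -/
def FullOnM {V : Type*} (q : V → Fin 3 → ℝ) (S : Set V) : Prop :=
  ∀ (lam : ℝ) (c : Fin 3 → ℝ),
    (∀ v ∈ S, lam • ![-(q v 1), q v 0, (0 : ℝ)] + c = 0) →
    ∀ x : Fin 3 → ℝ, lam • ![-(x 1), x 0, (0 : ℝ)] + c = 0

lemma norm2p_neg (p : ℝ) (v : Fin 3 → ℝ) : norm2p p (-v) = norm2p p v := by
  simp [norm2p]

lemma norm2p_add_smul_rotation_neg (p s : ℝ) (x : Fin 3 → ℝ) :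
    norm2p p (x + (-s) • ![-(x 1), x 0, 0]) = norm2p p (x + s • ![-(x 1), x 0, 0]) := by
  have h : (x 0 + s * x 1) ^ 2 + (x 1 + -(s * x 0)) ^ 2 =
      (x 0 + -(s * x 1)) ^ 2 + (x 1 + s * x 0) ^ 2 := by ring
  simp [norm2p, h]

lemma differentiableAt_norm2p {p : ℝ} (hp : 1 < p) {x : Fin 3 → ℝ} (hx : x ≠ 0) :
    DifferentiableAt ℝ (norm2p p) x := by
  have hplane : ∀ y : Fin 3 → ℝ,
      (y 0 ^ 2 + y 1 ^ 2) ^ (p / 2) = ‖(y 0 : ℂ) + y 1 * Complex.I‖ ^ p := by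
    intro y
    rw [Complex.norm_add_mul_I, Real.sqrt_eq_rpow, ← Real.rpow_mul (by positivity)]
    congr 1
    ring
  have hd₁ : DifferentiableAt ℝ (fun y : Fin 3 → ℝ => (y 0 ^ 2 + y 1 ^ 2) ^ (p / 2)) x := by
    simp_rw [hplane]
    have h := (contDiff_norm_rpow (E := ℂ) hp).differentiable one_ne_zero
    refine (h _).comp (f := fun y : Fin 3 → ℝ => (y 0 : ℂ) + y 1 * Complex.I) x ?_
    have hc : ∀ i : Fin 3, DifferentiableAt ℝ (fun y : Fin 3 → ℝ => (y i : ℂ)) x := fun i =>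
      Complex.ofRealCLM.differentiableAt.comp x (differentiableAt_apply i x)
    exact (hc 0).add ((hc 1).mul_const _)
  have hd₂ : DifferentiableAt ℝ (fun y : Fin 3 → ℝ => |y 2| ^ p) x := by
    have h := (contDiff_norm_rpow (E := ℝ) hp).differentiable one_ne_zero
    exact (h _).comp (f := fun y : Fin 3 → ℝ => y 2) x (differentiableAt_apply 2 x)
  refine (hd₁.add hd₂).rpow_const (Or.inl ?_)
  have h₁ : 0 ≤ (x 0 ^ 2 + x 1 ^ 2) ^ (p / 2) := by positivity
  have h₂ : 0 ≤ |x 2| ^ p := by positivity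
  intro h0
  simp only [Pi.add_apply] at h0
  have e₁ := (Real.rpow_eq_zero (by positivity) (by positivity)).1
    (show (x 0 ^ 2 + x 1 ^ 2) ^ (p / 2) = 0 by linarith)
  have e₂ := (Real.rpow_eq_zero (by positivity) (by positivity)).1
    (show |x 2| ^ p = 0 by linarith)
  apply hx
  ext i
  fin_cases i
  · exact (pow_eq_zero_iff two_ne_zero).1 (show x 0 ^ 2 = 0 by nlinarith)
  · exact (pow_eq_zero_iff two_ne_zero).1 (show x 1 ^ 2 = 0 by nlinarith)
  · exact abs_eq_zero.1 e₂

lemma hasDerivAt_norm2p_line {p : ℝ} (hp : 1 < p) {x : Fin 3 → ℝ} (hx : x ≠ 0)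
    (m : Fin 3 → ℝ) :
    HasDerivAt (fun t : ℝ => norm2p p (x + t • m)) (fderiv ℝ (norm2p p) x m) 0 := by
  have hline : HasDerivAt (fun t : ℝ => x + t • m) m 0 := by
    simpa using ((hasDerivAt_id (0 : ℝ)).smul_const m).const_add x
  have h : HasFDerivAt (norm2p p) (fderiv ℝ (norm2p p) x) (x + (0 : ℝ) • m) := by
    simpa using (differentiableAt_norm2p hp hx).hasFDerivAt
  exact h.comp_hasDerivAt (0 : ℝ) hline

lemma fderiv_norm2p_rotation {p : ℝ} (hp : 1 < p) {x : Fin 3 → ℝ} (hx : x ≠ 0) :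
    fderiv ℝ (norm2p p) x ![-(x 1), x 0, 0] = 0 := by
  have h := hasDerivAt_norm2p_line hp hx ![-(x 1), x 0, 0]
  have hneg := HasDerivAt.scomp (0 : ℝ) (by simpa only [neg_zero] using h) (hasDerivAt_neg (0 : ℝ))
  have heven : (fun t : ℝ => norm2p p (x + t • ![-(x 1), x 0, 0])) ∘ Neg.neg =
      fun t : ℝ => norm2p p (x + t • ![-(x 1), x 0, 0]) :=
    funext fun t => norm2p_add_smul_rotation_neg p t x
  rw [heven, neg_one_smul] at hneg
  linarith [h.unique hneg]

section Rigidity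

variable {V : Type*}

/-- The row of the rigidity matrix of `(G, q)` attached to the edge `e`, with an arbitrarily
chosen orientation of `e`. -/
noncomputable def rigidityRow (p : ℝ) (q : V → Fin 3 → ℝ) (e : Sym2 V) :
    (V → Fin 3 → ℝ) →ₗ[ℝ] ℝ :=
  (fderiv ℝ (norm2p p) (q e.out.1 - q e.out.2)).toLinearMap ∘ₗ
    ((LinearMap.proj e.out.1 : (V → Fin 3 → ℝ) →ₗ[ℝ] Fin 3 → ℝ) - LinearMap.proj e.out.2)

lemma rigidityRow_apply (p : ℝ) (q m : V → Fin 3 → ℝ) (e : Sym2 V) :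
    rigidityRow p q e m =
      fderiv ℝ (norm2p p) (q e.out.1 - q e.out.2) (m e.out.1 - m e.out.2) := rfl

lemma rigidityRow_congr (p : ℝ) (q : V → Fin 3 → ℝ) {e : Sym2 V} {m m' : V → Fin 3 → ℝ}
    (h : ∀ v ∈ e, m v = m' v) : rigidityRow p q e m = rigidityRow p q e m' := by
  rw [rigidityRow_apply, rigidityRow_apply, h _ e.out_fst_mem, h _ e.out_snd_mem]

lemma adj_out {G : SimpleGraph V} {e : Sym2 V} (he : e ∈ G.edgeSet) :
    G.Adj e.out.1 e.out.2 := by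
  have h : s(e.out.1, e.out.2) = e := Quot.out_eq e
  rwa [← SimpleGraph.mem_edgeSet, h]

/-- The infinitesimal rigid motion `x ↦ λ(−x₂, x₁, 0) + c`, evaluated at the placement `q`. -/
noncomputable def trivialFlex (q : V → Fin 3 → ℝ) :
    (ℝ × (Fin 3 → ℝ)) →ₗ[ℝ] (V → Fin 3 → ℝ) where
  toFun a v := a.1 • ![-(q v 1), q v 0, 0] + a.2
  map_add' a b := by
    funext v
    simp only [Prod.fst_add, Prod.snd_add, add_smul, Pi.add_apply]
    abel
  map_smul' r a := by
    funext v
    simp only [Prod.smul_fst, Prod.smul_snd, smul_eq_mul, mul_smul, smul_add, Pi.smul_apply,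
      RingHom.id_apply]

lemma trivialFlex_apply (q : V → Fin 3 → ℝ) (a : ℝ × (Fin 3 → ℝ)) (v : V) :
    trivialFlex q a v = a.1 • ![-(q v 1), q v 0, 0] + a.2 := rfl

lemma trivFlex_iff_mem_range {q m : V → Fin 3 → ℝ} :
    TrivFlex q m ↔ m ∈ LinearMap.range (trivialFlex q) := by
  constructor
  · rintro ⟨lam, c, h⟩
    exact ⟨(lam, c), funext fun v => (h v).symm⟩
  · rintro ⟨a, rfl⟩
    exact ⟨a.1, a.2, fun v => rfl⟩

lemma rigidityRow_trivialFlex {p : ℝ} (hp : 1 < p) (q : V → Fin 3 → ℝ) {e : Sym2 V}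
    (he : q e.out.1 ≠ q e.out.2) (a : ℝ × (Fin 3 → ℝ)) :
    rigidityRow p q e (trivialFlex q a) = 0 := by
  set x := q e.out.1 - q e.out.2 with hx
  have h : trivialFlex q a e.out.1 - trivialFlex q a e.out.2 = a.1 • ![-(x 1), x 0, 0] := by
    ext i
    fin_cases i <;> simp [trivialFlex_apply, hx] <;> ring
  rw [rigidityRow_apply, h, map_smul, fderiv_norm2p_rotation hp (sub_ne_zero.2 he), smul_zero]

lemma eq_zero_of_fullOnM {q : V → Fin 3 → ℝ} {S : Set V} (h : FullOnM q S)
    {a : ℝ × (Fin 3 → ℝ)} (ha : ∀ v ∈ S, trivialFlex q a v = 0) : a = 0 := by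
  have hx := h a.1 a.2 ha
  have hc : a.2 = 0 := by
    ext i
    have := congrFun (hx 0) i
    fin_cases i <;> simpa using this
  have hlam : a.1 = 0 := by
    simpa [hc] using congrFun (hx ![1, 0, 0]) 1
  exact Prod.ext hlam hc

lemma isFlexM_iff {p : ℝ} (hp : 1 < p) {G : SimpleGraph V} {q m : V → Fin 3 → ℝ}
    (hfw : ∀ v w, G.Adj v w → q v ≠ q w) :
    IsFlexM p G q m ↔ ∀ e ∈ G.edgeSet, rigidityRow p q e m = 0 := by
  have hline : ∀ v w : V, (fun t : ℝ => norm2p p ((q v + t • m v) - (q w + t • m w))) =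
      fun t : ℝ => norm2p p ((q v - q w) + t • (m v - m w)) := by
    intro v w
    funext t
    congr 1
    module
  have hrow : ∀ e ∈ G.edgeSet, HasDerivAt
      (fun t : ℝ => norm2p p ((q e.out.1 + t • m e.out.1) - (q e.out.2 + t • m e.out.2)))
      (rigidityRow p q e m) 0 := by
    intro e he
    rw [hline]
    exact hasDerivAt_norm2p_line hp (sub_ne_zero.2 (hfw _ _ (adj_out he))) _
  constructor
  · intro h e he
    exact (hrow e he).unique (h _ _ (adj_out he))
  · intro h v w hvw
    have he : s(v, w) ∈ G.edgeSet := hvw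
    have hd := hrow _ he
    rw [h _ he] at hd
    have hout : s((s(v, w)).out.1, (s(v, w)).out.2) = s(v, w) := Quot.out_eq _
    rcases Sym2.eq_iff.1 hout with ⟨h₁, h₂⟩ | ⟨h₁, h₂⟩
    · rwa [h₁, h₂] at hd
    · rw [h₁, h₂] at hd
      convert hd using 2 with t
      rw [← norm2p_neg, neg_sub]

/-- In a minimally infinitesimally rigid framework every edge is independent of the others. -/
lemma exists_rigidityRow_eq_one {p : ℝ} (hp : 1 < p) {G : SimpleGraph V} {q : V → Fin 3 → ℝ}
    (hfw : ∀ v w, G.Adj v w → q v ≠ q w) (hrigid : RigidM p G q) {e : Sym2 V}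
    (hmin : ¬ RigidM p (G.deleteEdges {e}) q) :
    ∃ m, rigidityRow p q e m = 1 ∧ ∀ f ∈ G.edgeSet, f ≠ e → rigidityRow p q f m = 0 := by
  simp only [RigidM, not_forall] at hmin
  obtain ⟨m, hm, hnt⟩ := hmin
  rw [isFlexM_iff hp fun v w h => hfw v w (SimpleGraph.deleteEdges_le {e} h)] at hm
  have hoff : ∀ f ∈ G.edgeSet, f ≠ e → rigidityRow p q f m = 0 := fun f hf hfe =>
    hm f (by simp [SimpleGraph.edgeSet_deleteEdges, hf, hfe])
  have hne : rigidityRow p q e m ≠ 0 := by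
    intro h0
    refine hnt (hrigid m ((isFlexM_iff hp hfw).2 fun f hf => ?_))
    by_cases hfe : f = e
    · rw [hfe, h0]
    · exact hoff f hf hfe
  refine ⟨(rigidityRow p q e m)⁻¹ • m, ?_, fun f hf hfe => ?_⟩
  · rw [map_smul, smul_eq_mul, inv_mul_cancel₀ hne]
  · rw [map_smul, hoff f hf hfe, smul_zero]

/-- Independent edges supported on a full set of vertices satisfy the Maxwell bound. -/
lemma card_edges_add_four_le {p : ℝ} (hp : 1 < p) {q : V → Fin 3 → ℝ} {S : Finset V}
    {E : Finset (Sym2 V)} (hne : ∀ e ∈ E, q e.out.1 ≠ q e.out.2)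
    (hES : ∀ e ∈ E, ∀ v ∈ e, v ∈ S) (hfull : FullOnM q ↑S)
    (hind : ∀ e ∈ E, ∃ m, rigidityRow p q e m = 1 ∧
      ∀ f ∈ E, f ≠ e → rigidityRow p q f m = 0) :
    E.card + 4 ≤ 3 * S.card := by
  classical
  let ext : (S → Fin 3 → ℝ) →ₗ[ℝ] (V → Fin 3 → ℝ) :=
    LinearMap.pi fun v => if h : v ∈ S then LinearMap.proj ⟨v, h⟩ else 0
  have hext : ∀ (m : V → Fin 3 → ℝ), ∀ v ∈ S, ext (fun w => m w) v = m v := by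
    intro m v hv
    simp [ext, hv]
  let R : (S → Fin 3 → ℝ) →ₗ[ℝ] (E → ℝ) :=
    LinearMap.pi fun e => rigidityRow p q e ∘ₗ ext
  have hR : ∀ (m : V → Fin 3 → ℝ) (e : E),
      R (fun w => m w) e = rigidityRow p q e m := fun m e =>
    rigidityRow_congr p q fun v hv => hext m v (hES e e.2 v hv)
  have hsurj : LinearMap.range R = ⊤ := by
    rw [eq_top_iff, ← (Pi.basisFun ℝ E).span_eq, Submodule.span_le]
    rintro _ ⟨e, rfl⟩
    obtain ⟨m, hm, hm'⟩ := hind e e.2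
    refine ⟨fun w => m w, funext fun f => ?_⟩
    rw [hR, Pi.basisFun_apply]
    by_cases hfe : f = e
    · rw [hfe, hm, Pi.single_eq_same]
    · rw [hm' f f.2 fun h => hfe (Subtype.ext h), Pi.single_eq_of_ne hfe]
  let T : (ℝ × (Fin 3 → ℝ)) →ₗ[ℝ] (S → Fin 3 → ℝ) :=
    LinearMap.funLeft ℝ (Fin 3 → ℝ) Subtype.val ∘ₗ trivialFlex q
  have hTinj : Function.Injective T := by
    rw [injective_iff_map_eq_zero]
    exact fun a ha => eq_zero_of_fullOnM hfull fun v hv => congrFun ha ⟨v, hv⟩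
  have hTker : LinearMap.range T ≤ LinearMap.ker R := by
    rintro _ ⟨a, rfl⟩
    exact funext fun e =>
      (hR (trivialFlex q a) e).trans (rigidityRow_trivialFlex hp q (hne e e.2) a)
  have h4 := Submodule.finrank_mono hTker
  rw [LinearMap.finrank_range_of_inj hTinj] at h4
  have hrank := R.finrank_range_add_finrank_ker
  rw [hsurj, finrank_top] at hrank
  simp [Module.finrank_pi_fintype] at h4 hrank
  omega

/-- An infinitesimally rigid framework has at least `3|V| - 4` edges. -/
lemma three_mul_card_le_card_edges_add_four [Fintype V] {p : ℝ} (hp : 1 < p)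
    {G : SimpleGraph V} {q : V → Fin 3 → ℝ} (hfw : ∀ v w, G.Adj v w → q v ≠ q w)
    (hrigid : RigidM p G q) :
    3 * Fintype.card V ≤ G.edgeSet.ncard + 4 := by
  classical
  let R : (V → Fin 3 → ℝ) →ₗ[ℝ] (G.edgeSet → ℝ) :=
    LinearMap.pi fun e => rigidityRow p q e
  have hker : LinearMap.ker R ≤ LinearMap.range (trivialFlex q) := fun m hm =>
    trivFlex_iff_mem_range.1 <| hrigid m <| (isFlexM_iff hp hfw).2 fun e he =>
      congrFun (LinearMap.mem_ker.1 hm) ⟨e, he⟩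
  have h4 := (Submodule.finrank_mono hker).trans (LinearMap.finrank_range_le _)
  have hrank := R.finrank_range_add_finrank_ker
  have hle := (LinearMap.range R).finrank_le
  rw [← Nat.card_coe_set_eq, Nat.card_eq_fintype_card]
  simp only [Module.finrank_prod, Module.finrank_self, Module.finrank_fintype_fun_eq_card,
    Module.finrank_pi_fintype, Fintype.card_fin, Finset.sum_const, Finset.card_univ,
    smul_eq_mul] at h4 hrank hle
  omega

lemma card_edges_le_choose_two {G : SimpleGraph V} {S : Finset V} {E : Finset (Sym2 V)}
    (hE : ↑E ⊆ G.edgeSet) (hES : ∀ e ∈ E, ∀ v ∈ e, v ∈ S) : E.card ≤ S.card.choose 2 := by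
  classical
  rw [← Sym2.card_image_offDiag]
  refine Finset.card_le_card fun e he => Finset.mem_image.2 ⟨e.out, ?_, Quot.out_eq e⟩
  exact Finset.mem_offDiag.2
    ⟨hES e he _ e.out_fst_mem, hES e he _ e.out_snd_mem, (adj_out (hE he)).ne⟩

end Rigidity

theorem stmt19 {V : Type*} [Fintype V] (p : ℝ) (hp1 : 1 < p) (hp2 : p ≠ 2)
    (G : SimpleGraph V) (hV : 6 ≤ Fintype.card V)
    (q : V → Fin 3 → ℝ) (hfw : ∀ v w, G.Adj v w → q v ≠ q w)
    (hfull : FullOnM q Set.univ)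
    (hcf : ∀ S : Finset V, 6 ≤ S.card → FullOnM q ↑S)
    (hrigid : RigidM p G q)
    (hmin : ∀ e ∈ G.edgeSet, ¬ RigidM p (G.deleteEdges {e}) q) :
    (G.edgeSet.ncard : ℤ) = 3 * Fintype.card V - 4 ∧
      ∀ (V' : Finset V) (E' : Finset (Sym2 V)), ↑E' ⊆ G.edgeSet →
        (∀ e ∈ E', ∀ v ∈ e, v ∈ V') → E'.Nonempty →
          (E'.card : ℤ) ≤ 3 * V'.card - 4 := by
  classical
  have hbound : ∀ (S : Finset V) (E : Finset (Sym2 V)), ↑E ⊆ G.edgeSet →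
      (∀ e ∈ E, ∀ v ∈ e, v ∈ S) → 6 ≤ S.card → E.card + 4 ≤ 3 * S.card := by
    intro S E hE hES hS
    refine card_edges_add_four_le hp1 (fun e he => hfw _ _ (adj_out (hE he))) hES (hcf S hS)
      fun e he => ?_
    obtain ⟨m, hm, hm'⟩ := exists_rigidityRow_eq_one hp1 hfw hrigid (hmin e (hE he))
    exact ⟨m, hm, fun f hf => hm' f (hE hf)⟩
  refine ⟨?_, fun S E hE hES hne => ?_⟩
  · have hle := hbound Finset.univ G.edgeFinset (by simp) (by simp) (by simpa using hV)
    have hge := three_mul_card_le_card_edges_add_four hp1 hfw hrigid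
    rw [← SimpleGraph.coe_edgeFinset, Set.ncard_coe_finset] at hge ⊢
    rw [Finset.card_univ] at hle
    omega
  · by_cases hS : 6 ≤ S.card
    · have := hbound S E hE hES hS
      omega
    · have hle := card_edges_le_choose_two hE hES
      have hpos := hne.card_pos
      generalize S.card = n at *
      have hn : n < 6 := not_le.1 hS
      rw [Nat.choose_two_right] at hle
      interval_cases n <;> omega
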